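/- Under the permutation null distribution, for n ≥ 4, assuming Var(R_out,d(t)) > 0 and Var(R_in,1(t)) > 0 for all t, the correlation between the standardized difference statistic and the standardized within-individual statistic does not depend on t: for every integer t with 1 ≤ t ≤ n−1, Cov(Z_out,d(t), Z_in(t)) = ϱ, where ϱ = ( Σ_{u=1}^n D_uu·D_u − (2/n)|G_in||G_out| ) / sqrt( (Σ_{u=1}^n D_u² − 4|G_out|²/n) · (Σ_{u=1}^n D_uu² − |G_in|²/n) ). -/

import Mathlib

open scoped BigOperators Classical

noncomputable section

namespace CPD

/-- Nodes: `n` individuals, each with `ℓ` repeated measurements. -/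
abbrev Node (n ℓ : ℕ) := Fin n × Fin ℓ

/-- The (unordered) pair of individuals joined by an edge. -/
def indPair {n ℓ : ℕ} (e : Sym2 (Node n ℓ)) : Sym2 (Fin n) := Sym2.map Prod.fst e

/-- Between-individual edges of the graph `Gr`. -/
def Gout {n ℓ : ℕ} (Gr : Finset (Sym2 (Node n ℓ))) : Finset (Sym2 (Node n ℓ)) :=
  Gr.filter fun e => ¬ (indPair e).IsDiag

/-- Within-individual edges of the graph `Gr`. -/
def Gin {n ℓ : ℕ} (Gr : Finset (Sym2 (Node n ℓ))) : Finset (Sym2 (Node n ℓ)) :=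
  Gr.filter fun e => (indPair e).IsDiag

/-- `D Gr u v`: the number of edges of `Gr` between individual `u` and individual `v`
(for `u = v`, the number of within-individual edges of individual `u`). -/
def D {n ℓ : ℕ} (Gr : Finset (Sym2 (Node n ℓ))) (u v : Fin n) : ℕ :=
  (Gr.filter fun e => indPair e = s(u, v)).card

/-- `Ddeg Gr u = ∑_{v ≠ u} D Gr u v`. -/
def Ddeg {n ℓ : ℕ} (Gr : Finset (Sym2 (Node n ℓ))) (u : Fin n) : ℕ :=
  ∑ v ∈ Finset.univ.filter fun v => v ≠ u, D Gr u v

/-- Number of between-individual edges both of whose endpoints belong to individuals whose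
permuted label (in `{1, …, n}`) is `≤ t`. -/
def Rout1 {n ℓ : ℕ} (Gr : Finset (Sym2 (Node n ℓ))) (t : ℕ) (σ : Equiv.Perm (Fin n)) : ℕ :=
  ((Gout Gr).filter fun e => ∀ x ∈ e, ((σ x.1 : ℕ) + 1 ≤ t)).card

/-- Number of between-individual edges both of whose endpoints belong to individuals whose
permuted label is `> t`. -/
def Rout2 {n ℓ : ℕ} (Gr : Finset (Sym2 (Node n ℓ))) (t : ℕ) (σ : Equiv.Perm (Fin n)) : ℕ :=
  ((Gout Gr).filter fun e => ∀ x ∈ e, (t ≤ (σ x.1 : ℕ))).card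

/-- Number of within-individual edges both of whose endpoints belong to individuals whose
permuted label is `≤ t`. -/
def Rin1 {n ℓ : ℕ} (Gr : Finset (Sym2 (Node n ℓ))) (t : ℕ) (σ : Equiv.Perm (Fin n)) : ℕ :=
  ((Gin Gr).filter fun e => ∀ x ∈ e, ((σ x.1 : ℕ) + 1 ≤ t)).card

/-- Expectation under the permutation null distribution (uniform over the `n!` permutations of
the individual labels). -/
def pexp {n : ℕ} (f : Equiv.Perm (Fin n) → ℝ) : ℝ :=
  (∑ σ : Equiv.Perm (Fin n), f σ) / (Nat.factorial n)

/-- Covariance under the permutation null distribution. -/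
def pcov {n : ℕ} (f g : Equiv.Perm (Fin n) → ℝ) : ℝ :=
  pexp fun σ => (f σ - pexp f) * (g σ - pexp g)

/-- Variance under the permutation null distribution. -/
def pvar {n : ℕ} (f : Equiv.Perm (Fin n) → ℝ) : ℝ := pcov f f

/-- The weighted edge-count statistic
`R_out,w(t) = ((n−t−1)·R_out,1(t) + (t−1)·R_out,2(t))/(n−2)`. -/
def Routw {n ℓ : ℕ} (Gr : Finset (Sym2 (Node n ℓ))) (t : ℕ) (σ : Equiv.Perm (Fin n)) : ℝ :=
  (((n : ℝ) - t - 1) * (Rout1 Gr t σ : ℝ) + ((t : ℝ) - 1) * (Rout2 Gr t σ : ℝ)) / ((n : ℝ) - 2)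

/-- The difference edge-count statistic `R_out,d(t) = R_out,1(t) − R_out,2(t)`. -/
def Routd {n ℓ : ℕ} (Gr : Finset (Sym2 (Node n ℓ))) (t : ℕ) (σ : Equiv.Perm (Fin n)) : ℝ :=
  (Rout1 Gr t σ : ℝ) - (Rout2 Gr t σ : ℝ)

/-- Standardized weighted between-individual statistic `Z_out,w(t)`. -/
def Zoutw {n ℓ : ℕ} (Gr : Finset (Sym2 (Node n ℓ))) (t : ℕ) (σ : Equiv.Perm (Fin n)) : ℝ :=
  (Routw Gr t σ - pexp (Routw Gr t)) / Real.sqrt (pvar (Routw Gr t))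

/-- Standardized difference statistic `Z_out,d(t)`. -/
def Zoutd {n ℓ : ℕ} (Gr : Finset (Sym2 (Node n ℓ))) (t : ℕ) (σ : Equiv.Perm (Fin n)) : ℝ :=
  (Routd Gr t σ - pexp (Routd Gr t)) / Real.sqrt (pvar (Routd Gr t))

/-- Standardized within-individual statistic `Z_in(t)`. -/
def Zin {n ℓ : ℕ} (Gr : Finset (Sym2 (Node n ℓ))) (t : ℕ) (σ : Equiv.Perm (Fin n)) : ℝ :=
  ((Rin1 Gr t σ : ℝ) - pexp (fun τ => (Rin1 Gr t τ : ℝ))) /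
    Real.sqrt (pvar (fun τ => (Rin1 Gr t τ : ℝ)))

/-- The constant
`ϱ = (Σ_u D_uu·D_u − (2/n)|G_in||G_out|) / sqrt((Σ_u D_u² − 4|G_out|²/n)(Σ_u D_uu² − |G_in|²/n))`. -/
def varrho {n ℓ : ℕ} (Gr : Finset (Sym2 (Node n ℓ))) : ℝ :=
  ((∑ u : Fin n, (D Gr u u : ℝ) * (Ddeg Gr u : ℝ)) -
      2 / (n : ℝ) * ((Gin Gr).card : ℝ) * ((Gout Gr).card : ℝ)) /
    Real.sqrt (((∑ u : Fin n, (Ddeg Gr u : ℝ) ^ 2) - 4 * ((Gout Gr).card : ℝ) ^ 2 / (n : ℝ)) *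
      ((∑ u : Fin n, (D Gr u u : ℝ) ^ 2) - ((Gin Gr).card : ℝ) ^ 2 / (n : ℝ)))

section PermutationMoments

variable {n : ℕ}

lemma pexp_sum {ι : Type*} (s : Finset ι) (f : ι → Equiv.Perm (Fin n) → ℝ) :
    pexp (fun σ => ∑ i ∈ s, f i σ) = ∑ i ∈ s, pexp (f i) := by
  simp only [pexp]
  rw [Finset.sum_comm, Finset.sum_div]

lemma pexp_const_mul (c : ℝ) (f : Equiv.Perm (Fin n) → ℝ) :
    pexp (fun σ => c * f σ) = c * pexp f := by
  simp only [pexp]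
  rw [← Finset.mul_sum, mul_div_assoc]

lemma pexp_add (f g : Equiv.Perm (Fin n) → ℝ) :
    pexp (fun σ => f σ + g σ) = pexp f + pexp g := by
  simp only [pexp]
  rw [Finset.sum_add_distrib, add_div]

lemma pexp_const (c : ℝ) : pexp (fun _ : Equiv.Perm (Fin n) => c) = c := by
  have h : (n.factorial : ℝ) ≠ 0 := by exact_mod_cast n.factorial_ne_zero
  simp [pexp, Fintype.card_perm, mul_div_cancel_left₀ _ h]

/-- The permutation null distribution is invariant under relabelling individuals. -/
lemma pexp_comp_mul_right (f : Equiv.Perm (Fin n) → ℝ) (ρ : Equiv.Perm (Fin n)) :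
    pexp (fun σ => f (σ * ρ)) = pexp f := by
  simp only [pexp]
  congr 1
  exact Equiv.sum_comp (Equiv.mulRight ρ) f

lemma pexp_apply_eq (g : Fin n → ℝ) (u v : Fin n) :
    pexp (fun σ => g (σ u)) = pexp (fun σ => g (σ v)) := by
  rw [← pexp_comp_mul_right (fun σ => g (σ v)) (Equiv.swap u v)]
  simp

lemma card_mul_pexp_apply (g : Fin n → ℝ) (u : Fin n) :
    (n : ℝ) * pexp (fun σ => g (σ u)) = ∑ i, g i := by
  have h : ∑ v : Fin n, pexp (fun σ => g (σ v)) = ∑ i, g i := by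
    rw [← pexp_sum Finset.univ (fun v σ => g (σ v))]
    simp only [Equiv.sum_comp, pexp_const]
  rw [← h, Finset.sum_congr rfl fun v _ => pexp_apply_eq g v u]
  simp

/-- Under the permutation null distribution a centred score has exchangeable second moments
summing to zero. -/
lemma pexp_apply_mul_apply (hn : 2 ≤ n) {h : Fin n → ℝ} (h0 : ∑ i, h i = 0) :
    ∃ α : ℝ, 0 ≤ α ∧ ∀ u v : Fin n,
      pexp (fun σ => h (σ u) * h (σ v)) = α * ((if u = v then 1 else 0) - 1 / n) := by
  have hn1 : (0 : ℝ) < (n : ℝ) - 1 := by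
    have : (2 : ℝ) ≤ n := by exact_mod_cast hn
    linarith
  have hn0 : (n : ℝ) ≠ 0 := by linarith
  set z : Fin n := ⟨0, by omega⟩
  set V : ℝ := pexp (fun σ => h (σ z) * h (σ z))
  have hdiag (u : Fin n) : pexp (fun σ => h (σ u) * h (σ u)) = V :=
    pexp_apply_eq (fun i => h i * h i) u z
  have hoff (u v : Fin n) (huv : v ≠ u) :
      pexp (fun σ => h (σ u) * h (σ v)) = -V / ((n : ℝ) - 1) := by
    have hsame (w : Fin n) (hw : w ∈ Finset.univ.erase u) :
        pexp (fun σ => h (σ u) * h (σ w)) = pexp (fun σ => h (σ u) * h (σ v)) := by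
      rw [← pexp_comp_mul_right (fun σ => h (σ u) * h (σ v)) (Equiv.swap v w)]
      simp [Equiv.swap_apply_of_ne_of_ne huv.symm (Finset.ne_of_mem_erase hw).symm]
    have hsum : ∑ w, pexp (fun σ => h (σ u) * h (σ w)) = 0 := by
      rw [← pexp_sum Finset.univ (fun w σ => h (σ u) * h (σ w))]
      simp only [← Finset.mul_sum, Equiv.sum_comp, h0, mul_zero, pexp_const]
    rw [← Finset.add_sum_erase _ _ (Finset.mem_univ u), hdiag, Finset.sum_congr rfl hsame,
      Finset.sum_const, Finset.card_erase_of_mem (Finset.mem_univ u), Finset.card_univ,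
      Fintype.card_fin, nsmul_eq_mul, Nat.cast_sub (by omega), Nat.cast_one] at hsum
    rw [eq_div_iff hn1.ne']
    linarith
  refine ⟨V * (n / (n - 1)), ?_, fun u v => ?_⟩
  · have hV0 : 0 ≤ V :=
      div_nonneg (Finset.sum_nonneg fun σ _ => mul_self_nonneg _) (Nat.cast_nonneg _)
    positivity
  · split_ifs with huv
    · subst huv
      rw [hdiag]
      field_simp
    · rw [hoff u v (Ne.symm huv)]
      field_simp
      ring

/-- The covariance of two linear rank statistics built from the same score is a fixed multiple
of the centred inner product of their coefficients. -/
lemma pcov_linear (hn : 2 ≤ n) (g : Fin n → ℝ) :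
    ∃ α : ℝ, 0 ≤ α ∧ ∀ (a b : Fin n → ℝ) (k m : ℝ),
      pcov (fun σ => ∑ u, a u * g (σ u) + k) (fun σ => ∑ u, b u * g (σ u) + m) =
        α * (∑ u, a u * b u - (∑ u, a u) * (∑ u, b u) / n) := by
  set z : Fin n := ⟨0, by omega⟩
  set μ : ℝ := pexp (fun σ => g (σ z))
  have h0 : ∑ i, (g i - μ) = 0 := by
    rw [Finset.sum_sub_distrib, ← card_mul_pexp_apply g z]
    simp [μ]
  obtain ⟨α, hα, hmom⟩ := pexp_apply_mul_apply hn h0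
  refine ⟨α, hα, fun a b k m => ?_⟩
  have hcenter (a : Fin n → ℝ) (k : ℝ) (σ : Equiv.Perm (Fin n)) :
      ∑ u, a u * g (σ u) + k - pexp (fun τ => ∑ u, a u * g (τ u) + k) =
        ∑ u, a u * (g (σ u) - μ) := by
    rw [pexp_add, pexp_const, pexp_sum Finset.univ (fun u τ => a u * g (τ u))]
    simp only [pexp_const_mul, pexp_apply_eq g _ z, mul_sub, Finset.sum_sub_distrib]
    ring
  have hterm (u v : Fin n) :
      pexp (fun σ => a u * (g (σ u) - μ) * (b v * (g (σ v) - μ))) =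
        α * ((if u = v then a u * b v else 0) - a u * b v / n) := by
    have hassoc (σ : Equiv.Perm (Fin n)) : a u * (g (σ u) - μ) * (b v * (g (σ v) - μ)) =
        a u * b v * ((g (σ u) - μ) * (g (σ v) - μ)) := by ring
    simp only [hassoc]
    rw [pexp_const_mul, hmom]
    split_ifs <;> ring
  simp only [pcov, hcenter, Finset.sum_mul_sum]
  simp only [pexp_sum, hterm, ← Finset.mul_sum _ _ α, Finset.sum_sub_distrib, Finset.sum_ite_eq,
    Finset.mem_univ, if_true, ← Finset.sum_div]

end PermutationMoments

section EdgeCounts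

variable {n ℓ : ℕ} (Gr : Finset (Sym2 (Node n ℓ)))

/-- The sum of `x` over the individuals of the two endpoints of an edge. -/
def endpointSum (x : Fin n → ℝ) : Sym2 (Node n ℓ) → ℝ :=
  Sym2.lift ⟨fun p q => x p.1 + x q.1, fun _ _ => add_comm _ _⟩

lemma sum_Ddeg_mul (x : Fin n → ℝ) :
    ∑ u, (Ddeg Gr u : ℝ) * x u = ∑ e ∈ Gout Gr, endpointSum x e := by
  simp only [Ddeg, D, Gout, Finset.card_filter, Finset.sum_filter, Nat.cast_sum, Nat.cast_ite,
    Nat.cast_one, Nat.cast_zero]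
  have hswap : ∀ u : Fin n, (∑ v : Fin n, if v ≠ u then
      ∑ e ∈ Gr, (if indPair e = s(u, v) then (1 : ℝ) else 0) else 0) * x u =
      ∑ e ∈ Gr, ∑ v : Fin n, if v ≠ u ∧ indPair e = s(u, v) then x u else 0 := by
    intro u
    rw [Finset.sum_comm, Finset.sum_mul]
    refine Finset.sum_congr rfl fun v _ => ?_
    by_cases h : v = u
    · simp [h]
    · simp only [ne_eq, h, not_false_eq_true, if_true, true_and, Finset.sum_mul, ite_mul, one_mul,
        zero_mul]
  rw [Finset.sum_congr rfl fun u _ => hswap u, Finset.sum_comm]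
  refine Finset.sum_congr rfl fun e _ => ?_
  induction e using Sym2.ind with
  | _ p q =>
    obtain ⟨a, i⟩ := p
    obtain ⟨b, j⟩ := q
    by_cases hab : a = b
    · subst hab
      rw [if_neg (by simp [indPair])]
      refine Finset.sum_eq_zero fun u _ => Finset.sum_eq_zero fun v _ => if_neg ?_
      rintro ⟨hvu, h⟩
      simp only [indPair, Sym2.map_mk, Sym2.eq_iff] at h
      grind
    · have hterm (u v : Fin n) :
          (if v ≠ u ∧ indPair s((a, i), (b, j)) = s(u, v) then x u else 0) =
            (if u = a then if v = b then x u else 0 else 0) +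
              (if u = b then if v = a then x u else 0 else 0) := by
        simp only [indPair, Sym2.map_mk, Sym2.eq_iff]
        grind
      rw [if_pos (by simpa [indPair] using hab),
        Finset.sum_congr rfl fun u _ => Finset.sum_congr rfl fun v _ => hterm u v]
      simp [endpointSum, Finset.sum_add_distrib]

lemma sum_D_self_mul (x : Fin n → ℝ) :
    ∑ u, (D Gr u u : ℝ) * x u = ∑ e ∈ Gin Gr, endpointSum x e / 2 := by
  simp only [D, Gin, Finset.card_filter, Finset.sum_filter, Nat.cast_sum, Nat.cast_ite,
    Nat.cast_one, Nat.cast_zero, Finset.sum_mul]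
  rw [Finset.sum_comm]
  refine Finset.sum_congr rfl fun e _ => ?_
  induction e using Sym2.ind with
  | _ p q =>
    obtain ⟨a, i⟩ := p
    obtain ⟨b, j⟩ := q
    by_cases hab : a = b
    · subst hab
      simp [indPair, endpointSum]
    · rw [if_neg (by simpa [indPair] using hab)]
      refine Finset.sum_eq_zero fun u _ => ?_
      rw [if_neg, zero_mul]
      simp only [indPair, Sym2.map_mk, Sym2.eq_iff]
      grind

lemma sum_Ddeg : ∑ u, (Ddeg Gr u : ℝ) = 2 * (Gout Gr).card := by
  have h := sum_Ddeg_mul Gr (fun _ => 1)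
  have he (e : Sym2 (Node n ℓ)) : endpointSum (fun _ => 1) e = 2 := by
    induction e using Sym2.ind with
    | _ p q => norm_num [endpointSum]
  simp only [mul_one, he, Finset.sum_const, nsmul_eq_mul] at h
  rw [h, mul_comm]

lemma sum_D_self : ∑ u, (D Gr u u : ℝ) = (Gin Gr).card := by
  have h := sum_D_self_mul Gr (fun _ => 1)
  have he (e : Sym2 (Node n ℓ)) : endpointSum (fun _ => 1) e = 2 := by
    induction e using Sym2.ind with
    | _ p q => norm_num [endpointSum]
  simpa [he] using h

/-- The indicator that a label (in `{1, …, n}`) is at most `t`. -/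
def lowLabel (t : ℕ) (i : Fin n) : ℝ := if (i : ℕ) + 1 ≤ t then 1 else 0

lemma Routd_eq (t : ℕ) : Routd Gr t =
    fun σ => ∑ u, (Ddeg Gr u : ℝ) * lowLabel t (σ u) + -((Gout Gr).card : ℝ) := by
  funext σ
  rw [sum_Ddeg_mul Gr (fun u => lowLabel t (σ u)), Routd, Rout1, Rout2, Finset.card_filter,
    Finset.card_filter, Finset.card_eq_sum_ones]
  push_cast
  rw [← Finset.sum_sub_distrib, ← sub_eq_add_neg, ← Finset.sum_sub_distrib]
  refine Finset.sum_congr rfl fun e _ => ?_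
  induction e using Sym2.ind with
  | _ p q =>
    simp only [Sym2.mem_iff, forall_eq_or_imp, forall_eq, endpointSum, Sym2.lift_mk, lowLabel]
    split_ifs <;> first | omega | norm_num

lemma Rin1_eq (t : ℕ) : (fun σ => (Rin1 Gr t σ : ℝ)) =
    fun σ => ∑ u, (D Gr u u : ℝ) * lowLabel t (σ u) + 0 := by
  funext σ
  rw [add_zero, sum_D_self_mul Gr (fun u => lowLabel t (σ u)), Rin1, Finset.card_filter]
  push_cast
  refine Finset.sum_congr rfl fun e he => ?_
  induction e using Sym2.ind with
  | _ p q =>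
    obtain ⟨a, i⟩ := p
    obtain ⟨b, j⟩ := q
    have hab : a = b := by simpa [Gin, indPair] using (Finset.mem_filter.mp he).2
    subst hab
    simp only [Sym2.mem_iff, forall_eq_or_imp, forall_eq, endpointSum, Sym2.lift_mk, lowLabel]
    split_ifs <;> first | omega | norm_num

end EdgeCounts

/-- The covariance of standardized statistics is the correlation. -/
lemma pcov_standardized {n : ℕ} (f g : Equiv.Perm (Fin n) → ℝ) (s r : ℝ) :
    pcov (fun σ => (f σ - pexp f) / s) (fun σ => (g σ - pexp g) / r) = pcov f g / (s * r) := by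
  have hzero (f : Equiv.Perm (Fin n) → ℝ) (s : ℝ) :
      pexp (fun σ => (f σ - pexp f) / s) = 0 := by
    simp only [div_eq_inv_mul, sub_eq_add_neg]
    rw [pexp_const_mul, pexp_add, pexp_const, add_neg_cancel, mul_zero]
  simp only [pcov, hzero, sub_zero, div_mul_div_comm]
  simp only [div_eq_inv_mul, pexp_const_mul]

/-- The correlation between the standardized difference statistic and the
standardized within-individual statistic does not depend on `t` and equals `ϱ`. -/
theorem cov_Zoutd_Zin (n ℓ : ℕ) (Gr : Finset (Sym2 (Node n ℓ)))
    (hG : ∀ e ∈ Gr, ¬ e.IsDiag) (hn : 4 ≤ n)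
    (hvd : ∀ t : ℕ, 1 ≤ t → t ≤ n - 1 → 0 < pvar (Routd Gr t))
    (hvi : ∀ t : ℕ, 1 ≤ t → t ≤ n - 1 → 0 < pvar (fun σ => (Rin1 Gr t σ : ℝ))) :
    ∀ t : ℕ, 1 ≤ t → t ≤ n - 1 → pcov (Zoutd Gr t) (Zin Gr t) = varrho Gr := by
  intro t ht1 htn
  have hX := hvd t ht1 htn
  have hY := hvi t ht1 htn
  obtain ⟨α, hα, hcov⟩ := pcov_linear (by omega : 2 ≤ n) (lowLabel t)
  have hN : pcov (Routd Gr t) (fun σ => (Rin1 Gr t σ : ℝ)) =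
      α * ((∑ u : Fin n, (D Gr u u : ℝ) * (Ddeg Gr u : ℝ)) -
        2 / (n : ℝ) * ((Gin Gr).card : ℝ) * ((Gout Gr).card : ℝ)) := by
    rw [Routd_eq, Rin1_eq, hcov, sum_Ddeg, sum_D_self]
    simp only [mul_comm (D Gr _ _ : ℝ)]
    ring
  have hX' : pvar (Routd Gr t) = α * ((∑ u : Fin n, (Ddeg Gr u : ℝ) ^ 2) -
      4 * ((Gout Gr).card : ℝ) ^ 2 / (n : ℝ)) := by
    rw [pvar, Routd_eq, hcov, sum_Ddeg]
    simp only [sq]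
    ring
  have hY' : pvar (fun σ => (Rin1 Gr t σ : ℝ)) = α * ((∑ u : Fin n, (D Gr u u : ℝ) ^ 2) -
      ((Gin Gr).card : ℝ) ^ 2 / (n : ℝ)) := by
    rw [pvar, Rin1_eq, hcov, sum_D_self]
    simp only [sq]
  have hα0 : α ≠ 0 := by
    rintro rfl
    rw [hX', zero_mul] at hX
    exact hX.false
  have hstd := pcov_standardized (Routd Gr t) (fun σ => (Rin1 Gr t σ : ℝ))
    (Real.sqrt (pvar (Routd Gr t))) (Real.sqrt (pvar (fun σ => (Rin1 Gr t σ : ℝ))))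
  refine hstd.trans ?_
  rw [← Real.sqrt_mul hX.le, hN, hX', hY', mul_mul_mul_comm, Real.sqrt_mul (mul_self_nonneg α),
    Real.sqrt_mul_self hα, mul_div_mul_left _ _ hα0, varrho]

end CPD
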